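/- On ℝ³ with coordinates p = (x,y,z), consider the Heisenberg contact sub-Riemannian structure given by ω_p(v) = v₃ + x·v₂ − y·v₁ (the contact form dz + x dy − y dx) and the constant symmetric bilinear form h(v,w) = v₁w₁ + v₂w₂. Let k ≥ 1 and let δ : ℝ → ℝ be smooth with δ^{(j)}(0) = 0 for all 0 ≤ j ≤ k. Define f(x,y,z) = (x + δ(z), y + δ(z), z) and β_p(v) = δ'(z)·(v₁ + v₂) + δ'(z)²·v₃. Then: (i) the map p ↦ (f*ω)_p − ω_p vanishes to order k at 0; (ii) the map p ↦ (f*h)_p − h_p − (ω_p ⊗ β_p + β_p ⊗ ω_p) vanishes to order k at 0; (iii) the map f − id vanishes to order k at 0 (f has trivial k-jet at 0); (iv) if moreover δ^{(k+1)}(0) ≠ 0, then the (k+1)-st iterated derivative of f at 0 is nonzero. Hence for every k there are (k+1)-infinitesimal isometries of this structure at 0 with trivial k-jet and nontrivial (k+1)-jet, so the structure is k-rigid for no k. -/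

import Mathlib

/-- A map from `ℝⁿ` to a normed space vanishes to order `k` at `0`: all its iterated
Fréchet derivatives of order `≤ k` vanish at `0` (order `0` being the value itself). -/
def VanishesToOrderAtZero {n : ℕ} {F : Type*} [NormedAddCommGroup F] [NormedSpace ℝ F]
    (G : (Fin n → ℝ) → F) (k : ℕ) : Prop :=
  ∀ j ≤ k, iteratedFDeriv ℝ j G 0 = 0

/-- The pullback of a continuous bilinear form `B` by a continuous linear map `A`:
`(v, w) ↦ B (A v) (A w)`. -/
noncomputable def pullbackBilin {n : ℕ}
    (B : (Fin n → ℝ) →L[ℝ] (Fin n → ℝ) →L[ℝ] ℝ)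
    (A : (Fin n → ℝ) →L[ℝ] (Fin n → ℝ)) :
    (Fin n → ℝ) →L[ℝ] (Fin n → ℝ) →L[ℝ] ℝ :=
  ((B.comp A).flip.comp A).flip

/-- The `i`-th coordinate projection on `ℝ³`, as a continuous linear form. -/
noncomputable def pr (i : Fin 3) : (Fin 3 → ℝ) →L[ℝ] ℝ :=
  ContinuousLinearMap.proj i

/-- The Heisenberg contact form `ω = dz + x dy − y dx` on `ℝ³`:
`ω_p(v) = v₃ + x·v₂ − y·v₁`. -/
noncomputable def ωH (p : Fin 3 → ℝ) : (Fin 3 → ℝ) →L[ℝ] ℝ :=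
  pr 2 + p 0 • pr 1 - p 1 • pr 0

/-- The constant symmetric bilinear form `dx² + dy²` on `ℝ³`: `h(v,w) = v₁w₁ + v₂w₂`. -/
noncomputable def hH : (Fin 3 → ℝ) →L[ℝ] (Fin 3 → ℝ) →L[ℝ] ℝ :=
  (pr 0).smulRight (pr 0) + (pr 1).smulRight (pr 1)

/-- The map `f(x,y,z) = (x + δ(z), y + δ(z), z)`. -/
noncomputable def fH (δ : ℝ → ℝ) (p : Fin 3 → ℝ) : Fin 3 → ℝ :=
  ![p 0 + δ (p 2), p 1 + δ (p 2), p 2]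

/-- The correction form `β_p(v) = δ'(z)·(v₁ + v₂) + δ'(z)²·v₃`. -/
noncomputable def βH (δ : ℝ → ℝ) (p : Fin 3 → ℝ) : (Fin 3 → ℝ) →L[ℝ] ℝ :=
  deriv δ (p 2) • (pr 0 + pr 1) + (deriv δ (p 2)) ^ 2 • pr 2

open scoped ContDiff

namespace VanishesToOrderAtZero

variable {n : ℕ} {F : Type*} [NormedAddCommGroup F] [NormedSpace ℝ F] {k : ℕ}

lemma add {G H : (Fin n → ℝ) → F} (hG : VanishesToOrderAtZero G k)
    (hH : VanishesToOrderAtZero H k) (hGs : ContDiff ℝ ∞ G) (hHs : ContDiff ℝ ∞ H) :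
    VanishesToOrderAtZero (fun p => G p + H p) k := by
  intro j hj
  have hle : (j : WithTop ℕ∞) ≤ ∞ := mod_cast le_top
  rw [fun_iteratedFDeriv_add (hGs.of_le hle) (hHs.of_le hle)]
  simp only [hG j hj, hH j hj, add_zero]

lemma smul {g : (Fin n → ℝ) → ℝ} {u : (Fin n → ℝ) → F} (hg : VanishesToOrderAtZero g k)
    (hgs : ContDiff ℝ ∞ g) (hus : ContDiff ℝ ∞ u) :
    VanishesToOrderAtZero (fun p => g p • u p) k := by
  intro j hj
  have hle : (j : WithTop ℕ∞) ≤ ∞ := mod_cast le_top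
  refine norm_le_zero_iff.1 ((norm_iteratedFDeriv_smul_le hgs hus 0 hle).trans_eq
    (Finset.sum_eq_zero fun i hi => ?_))
  rw [hg i ((Finset.mem_range_succ_iff.1 hi).trans hj)]
  simp

/-- Multiplying by a function that vanishes at `0` raises the order of vanishing by one. -/
lemma smul_succ {a : (Fin n → ℝ) → ℝ} {G : (Fin n → ℝ) → F} (ha : a 0 = 0)
    (hG : VanishesToOrderAtZero G k) (has : ContDiff ℝ ∞ a) (hGs : ContDiff ℝ ∞ G) :
    VanishesToOrderAtZero (fun p => a p • G p) (k + 1) := by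
  intro j hj
  have hle : (j : WithTop ℕ∞) ≤ ∞ := mod_cast le_top
  refine norm_le_zero_iff.1 ((norm_iteratedFDeriv_smul_le has hGs 0 hle).trans_eq
    (Finset.sum_eq_zero fun i _ => ?_))
  rcases Nat.eq_zero_or_pos i with rfl | hi
  · simp [ha]
  · rw [hG (j - i) (by omega)]
    simp

lemma comp_clm {g : ℝ → ℝ} (hg : ContDiff ℝ ∞ g) (hg0 : ∀ j ≤ k, iteratedDeriv j g 0 = 0)
    (L : (Fin n → ℝ) →L[ℝ] ℝ) : VanishesToOrderAtZero (fun p => g (L p)) k := by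
  intro j hj
  have hle : (j : WithTop ℕ∞) ≤ ∞ := mod_cast le_top
  have h0 : iteratedFDeriv ℝ j g 0 = 0 := by
    rw [← norm_eq_zero, norm_iteratedFDeriv_eq_norm_iteratedDeriv, hg0 j hj, norm_zero]
  have h := L.iteratedFDeriv_comp_right hg 0 hle
  rw [map_zero, h0] at h
  exact h.trans (by ext; simp)

end VanishesToOrderAtZero

lemma ContDiff.real_smul {E F : Type*} [NormedAddCommGroup E] [NormedSpace ℝ E]
    [NormedAddCommGroup F] [NormedSpace ℝ F] {g : E → ℝ} {u : E → F} (hg : ContDiff ℝ ∞ g)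
    (hu : ContDiff ℝ ∞ u) : ContDiff ℝ ∞ fun p => g p • u p :=
  hg.smul hu

lemma contDiff_apply_two {g : ℝ → ℝ} (hg : ContDiff ℝ ∞ g) :
    ContDiff ℝ ∞ fun p : Fin 3 → ℝ => g (p 2) :=
  hg.comp (contDiff_apply ℝ ℝ 2)

lemma fH_eq (δ : ℝ → ℝ) (p : Fin 3 → ℝ) : fH δ p = p + δ (p 2) • ![1, 1, 0] := by
  ext i
  fin_cases i <;> simp [fH]

lemma fderiv_fH_apply {δ : ℝ → ℝ} (hδ : Differentiable ℝ δ) (p v : Fin 3 → ℝ) :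
    fderiv ℝ (fH δ) p v =
      ![v 0 + deriv δ (p 2) * v 2, v 1 + deriv δ (p 2) * v 2, v 2] := by
  have h2 : HasFDerivAt (fun q : Fin 3 → ℝ => δ (q 2)) (deriv δ (p 2) • pr 2) p :=
    (hδ (p 2)).hasDerivAt.comp_hasFDerivAt p (pr 2).hasFDerivAt
  have h : HasFDerivAt (fH δ)
      (ContinuousLinearMap.id ℝ _ + (deriv δ (p 2) • pr 2).smulRight ![1, 1, 0]) p := by
    rw [funext (fH_eq δ)]
    exact (hasFDerivAt_id p).add (h2.smul_const _)
  rw [h.fderiv]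
  ext i
  fin_cases i <;> simp [pr]

lemma pullback_ωH_sub_ωH {δ : ℝ → ℝ} (hδ : Differentiable ℝ δ) (p : Fin 3 → ℝ) :
    (ωH (fH δ p)).comp (fderiv ℝ (fH δ) p) - ωH p =
      δ (p 2) • (pr 1 - pr 0) + (p 0 - p 1) • deriv δ (p 2) • pr 2 := by
  refine ContinuousLinearMap.ext fun v => ?_
  simp [fderiv_fH_apply hδ, ωH, fH, pr]
  ring

lemma pullbackBilin_hH_sub_hH {δ : ℝ → ℝ} (hδ : Differentiable ℝ δ) (p : Fin 3 → ℝ) :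
    pullbackBilin hH (fderiv ℝ (fH δ) p) - hH
        - (ωH p).smulRight (βH δ p) - (βH δ p).smulRight (ωH p) =
      p 1 • deriv δ (p 2) • ((pr 0).smulRight (pr 0 + pr 1) + (pr 0 + pr 1).smulRight (pr 0)
        + deriv δ (p 2) • ((pr 0).smulRight (pr 2) + (pr 2).smulRight (pr 0))) +
      (-p 0) • deriv δ (p 2) • ((pr 1).smulRight (pr 0 + pr 1) + (pr 0 + pr 1).smulRight (pr 1)
        + deriv δ (p 2) • ((pr 1).smulRight (pr 2) + (pr 2).smulRight (pr 1))) := by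
  refine ContinuousLinearMap.ext fun v => ContinuousLinearMap.ext fun w => ?_
  simp [pullbackBilin, fderiv_fH_apply hδ, ωH, hH, βH, pr]
  ring

lemma contDiff_fH {δ : ℝ → ℝ} (hδ : ContDiff ℝ ∞ δ) : ContDiff ℝ ∞ (fH δ) := by
  rw [funext (fH_eq δ)]
  exact contDiff_id.add ((contDiff_apply_two hδ).smul contDiff_const)

lemma iteratedFDeriv_fH_ne_zero {δ : ℝ → ℝ} (hδ : ContDiff ℝ ∞ δ) {m : ℕ}
    (hm : iteratedDeriv m δ 0 ≠ 0) : iteratedFDeriv ℝ m (fH δ) 0 ≠ 0 := by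
  intro h0
  apply hm
  have hle : (m : WithTop ℕ∞) ≤ ∞ := mod_cast le_top
  let L : ℝ →L[ℝ] (Fin 3 → ℝ) := ContinuousLinearMap.toSpanSingleton ℝ ![0, 0, 1]
  have hδL : δ = pr 0 ∘ (fH δ ∘ L) := by
    funext t
    simp [L, pr, fH]
  have h1 : iteratedFDeriv ℝ m (fH δ ∘ L) 0 = 0 := by
    rw [L.iteratedFDeriv_comp_right (contDiff_fH hδ) 0 hle, map_zero, h0]
    ext
    simp
  have h2 : iteratedFDeriv ℝ m δ 0 = 0 := by
    rw [hδL, (pr 0).iteratedFDeriv_comp_left ((contDiff_fH hδ).comp L.contDiff).contDiffAt hle, h1]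
    ext
    simp
  rw [← norm_eq_zero, ← norm_iteratedFDeriv_eq_norm_iteratedDeriv, h2, norm_zero]

/-- **The Heisenberg contact sub-Riemannian structure on `ℝ³` is `k`-rigid for no `k`:**
for every `k ≥ 1` and every smooth `δ : ℝ → ℝ` whose derivatives of order `≤ k` vanish
at `0`, the map `f(x,y,z) = (x + δ(z), y + δ(z), z)` is a `(k+1)`-infinitesimal isometry
of `(ker(dz + x dy − y dx), dx² + dy²)` at `0` with trivial `k`-jet; and if moreover
`δ^{(k+1)}(0) ≠ 0`, then `f` has nontrivial `(k+1)`-jet at `0`. -/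
theorem heisenberg_not_k_rigid (k : ℕ) (hk : 1 ≤ k)
    (δ : ℝ → ℝ) (hδ : ContDiff ℝ (⊤ : ℕ∞) δ)
    (hδ0 : ∀ j ≤ k, iteratedDeriv j δ 0 = 0) :
    VanishesToOrderAtZero
      (fun p => (ωH (fH δ p)).comp (fderiv ℝ (fH δ) p) - ωH p) k ∧
    VanishesToOrderAtZero
      (fun p => pullbackBilin hH (fderiv ℝ (fH δ) p) - hH
        - (ωH p).smulRight (βH δ p) - (βH δ p).smulRight (ωH p)) k ∧
    VanishesToOrderAtZero (fun p => fH δ p - p) k ∧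
    (iteratedDeriv (k + 1) δ 0 ≠ 0 → iteratedFDeriv ℝ (k + 1) (fH δ) 0 ≠ 0) := by
  have hd : Differentiable ℝ δ := hδ.differentiable (by simp)
  have hδ' : ContDiff ℝ ∞ (deriv δ) := (contDiff_infty_iff_deriv.1 hδ).2
  have hs := contDiff_apply_two hδ
  have hs' := contDiff_apply_two hδ'
  have hx (i : Fin 3) : ContDiff ℝ ∞ fun p : Fin 3 → ℝ => p i := contDiff_apply ℝ ℝ i
  have hv : VanishesToOrderAtZero (fun p : Fin 3 → ℝ => δ (p 2)) k := .comp_clm hδ hδ0 (pr 2)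
  obtain ⟨m, rfl⟩ : ∃ m, k = m + 1 := ⟨k - 1, by omega⟩
  have hv' : VanishesToOrderAtZero (fun p : Fin 3 → ℝ => deriv δ (p 2)) m :=
    .comp_clm hδ' (fun j hj => by rw [← iteratedDeriv_succ']; exact hδ0 _ (by omega)) (pr 2)
  refine ⟨?_, ?_, ?_, iteratedFDeriv_fH_ne_zero hδ⟩
  · simp_rw [pullback_ωH_sub_ωH hd]
    have hc := hs'.smul (contDiff_const (c := pr 2))
    exact (hv.smul hs contDiff_const).add
      (.smul_succ (by simp) (hv'.smul hs' contDiff_const) ((hx 0).sub (hx 1)) hc)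
      (hs.smul contDiff_const) (((hx 0).sub (hx 1)).smul hc)
  · simp_rw [pullbackBilin_hH_sub_hH hd]
    have hu (S T : (Fin 3 → ℝ) →L[ℝ] (Fin 3 → ℝ) →L[ℝ] ℝ) :
        ContDiff ℝ ∞ fun p : Fin 3 → ℝ => S + deriv δ (p 2) • T :=
      contDiff_const.add (hs'.real_smul contDiff_const)
    exact .add
      (.smul_succ (by simp) (hv'.smul hs' (hu _ _)) (hx 1) (hs'.real_smul (hu _ _)))
      (.smul_succ (by simp) (hv'.smul hs' (hu _ _)) (hx 0).neg (hs'.real_smul (hu _ _)))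
      ((hx 1).real_smul (hs'.real_smul (hu _ _))) ((hx 0).neg.real_smul (hs'.real_smul (hu _ _)))
  · simp_rw [fH_eq, add_sub_cancel_left]
    exact hv.smul hs contDiff_const
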